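/- arXiv:2401.04697 — 2 statements merged into one kernel-verified Lean document; each statement's English description precedes it below -/
import Mathlib

section
/- Let T be a complete theory with monster model M, let (a_g)_{g∈G_n} be a sequence of tuples from M that is O_n-indiscernible over a set A, let D be a ∅-definable set that is n-hanced stably embedded, and fix d ∈ D. If the induced structure on D is NIP_n, then no formula with parameters in A ∪ {d} can encode the edges of (a_g)_{g∈G_n}; that is, there is no formula φ(d; y_1,…,y_n) over A ∪ {d} such that M ⊨ φ(d, a_{g_1},…,a_{g_n}) holds iff (g_1,…,g_n) is an edge of G_n. -/
open FirstOrder FirstOrder.Language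

namespace Paper

/-- Abbreviation for first-order languages (with everything in `Type 0`). -/
abbrev Lang : Type 1 := FirstOrder.Language.{0, 0}

/-! ## Generic `NIP_n` notions -/

section NIPn

variable {L : Lang}

/-- The `IP_n` pattern for a formula `φ(x; y₁,…,yₙ)` (with `x` a `k`-tuple of variables and
each `yⱼ` an `m`-tuple of variables), realized in an `L`-structure `M`:
there are `(aʲᵢ)_{i<ω}` for `1 ≤ j ≤ n` and `(b_J)_{J ⊆ ω^n}` such that
`φ(b_J, a¹_{i₁}, …, aⁿ_{iₙ})` holds iff `(i₁,…,iₙ) ∈ J`. -/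
def HasIPnPattern (n : ℕ) {M : Type} [L.Structure M] {k m : ℕ}
    (φ : L.Formula (Fin k ⊕ (Fin n × Fin m))) : Prop :=
  ∃ (a : Fin n → ℕ → Fin m → M) (b : Set (Fin n → ℕ) → Fin k → M),
    ∀ (J : Set (Fin n → ℕ)) (i : Fin n → ℕ),
      (φ.Realize (Sum.elim (b J) (fun p => a p.1 (i p.1) p.2)) ↔ i ∈ J)

/-- A theory is `NIP_n` if no formula `φ(x; y₁,…,yₙ)` has the `IP_n` pattern in any model. -/
def TheoryIsNIPn (T : L.Theory) (n : ℕ) : Prop :=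
  ∀ (M : Theory.ModelType.{0, 0, 0} T) (k m : ℕ) (φ : L.Formula (Fin k ⊕ (Fin n × Fin m))),
    ¬ HasIPnPattern n (M := M) φ

/-- A formula is `NIP_n` with respect to a theory `T` if it has the `IP_n` pattern
in no model of `T`. -/
def FormulaIsNIPn (T : L.Theory) (n : ℕ) {k m : ℕ}
    (φ : L.Formula (Fin k ⊕ (Fin n × Fin m))) : Prop :=
  ∀ M : Theory.ModelType.{0, 0, 0} T, ¬ HasIPnPattern n (M := M) φ

/-- A structure is `NIP_n` if its complete theory is. -/
def IsNIPn (L : Lang) (M : Type) [L.Structure M] (n : ℕ) : Prop :=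
  TheoryIsNIPn (L.completeTheory M) n

/-- `D` is `NIP_n` with its induced structure (inside the ambient, monster, structure `M`):
no formula admits an `IP_n` pattern all of whose witnesses come from `D`. -/
def InducedNIPn (L : Lang) (M : Type) [L.Structure M] (n : ℕ) (D : Set M) : Prop :=
  ∀ (k m : ℕ) (φ : L.Formula (Fin k ⊕ (Fin n × Fin m))),
    ¬ ∃ (a : Fin n → ℕ → Fin m → M) (b : Set (Fin n → ℕ) → Fin k → M),
      (∀ j i l, a j i l ∈ D) ∧ (∀ J l, b J l ∈ D) ∧
      ∀ (J : Set (Fin n → ℕ)) (i : Fin n → ℕ),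
        (φ.Realize (Sum.elim (b J) (fun p => a p.1 (i p.1) p.2)) ↔ i ∈ J)

/-- A "monster model": saturation for types over countably many parameters (in countably
many variables) together with strong homogeneity over countable sets. -/
def IsMonster (L : Lang) (M : Type) [L.Structure M] : Prop :=
  (∀ (ι κ : Type), Countable ι → Countable κ →
    ∀ (c : κ → M) (Φ : Set (L.Formula (ι ⊕ κ))),
      (∀ Φ₀ : Set (L.Formula (ι ⊕ κ)), Φ₀ ⊆ Φ → Φ₀.Finite →
        ∃ x : ι → M, ∀ φ ∈ Φ₀, φ.Realize (Sum.elim x c)) →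
      ∃ x : ι → M, ∀ φ ∈ Φ, φ.Realize (Sum.elim x c)) ∧
  (∀ (κ : Type), Countable κ → ∀ c d : κ → M,
    (∀ (k : ℕ) (ix : Fin k → κ) (φ : L.Formula (Fin k)),
      φ.Realize (c ∘ ix) ↔ φ.Realize (d ∘ ix)) →
    ∃ σ : M ≃[L] M, ∀ i, σ (c i) = d i)

/-- A `∅`-definable set `D` (of singletons) in `M` is *n-hanced stably embedded* if for every
formula `φ(x, y₁,…,yₙ)` and all sequences `(aᵢᵏ)_{i ∈ I}` (`1 ≤ k ≤ n`) of tuples from `M`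
there are a formula `ψ(x, z₁,…,zₙ)` and tuples `(bᵢᵏ)_{i ∈ I}` from `D` such that
`φ(D, a¹_{i₁},…,aⁿ_{iₙ}) = ψ(D, b¹_{i₁},…,bⁿ_{iₙ})` for all indices `i₁,…,iₙ ∈ I`. -/
def NHancedSE (L : Lang) (M : Type) [L.Structure M] (n : ℕ) (D : Set M) : Prop :=
  ∀ (I : Type) (k m : ℕ) (φ : L.Formula (Fin k ⊕ (Fin n × Fin m)))
    (a : Fin n → I → Fin m → M),
    ∃ (m' : ℕ) (ψ : L.Formula (Fin k ⊕ (Fin n × Fin m')))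
      (b : Fin n → I → Fin m' → M),
      (∀ j i l, b j i l ∈ D) ∧
      ∀ (i : Fin n → I) (x : Fin k → M), (∀ l, x l ∈ D) →
        (φ.Realize (Sum.elim x (fun p => a p.1 (i p.1) p.2)) ↔
          ψ.Realize (Sum.elim x (fun p => b p.1 (i p.1) p.2)))

end NIPn

end Paper

namespace Paper

/-! ## Ordered random `n`-partite `n`-hypergraphs and generalized indiscernibles -/

/-- A countable ordered `n`-partite set: the reduct `O_n` (axioms 1–3). -/
structure OrderedNPartite (n : ℕ) where
  G : Type
  countable : Countable G
  part : G → Fin n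
  lt : G → G → Prop
  lt_irrefl : ∀ g, ¬ lt g g
  lt_trans : ∀ a b c, lt a b → lt b c → lt a c
  lt_total : ∀ a b, lt a b ∨ a = b ∨ lt b a
  parts_ordered : ∀ a b, part a < part b → lt a b
  lt_part_mono : ∀ a b, lt a b → part a ≤ part b
  parts_nonempty : ∀ i : Fin n, ∃ g, part g = i
  dense : ∀ a b, part a = part b → lt a b → ∃ c, part c = part a ∧ lt a c ∧ lt c b
  no_top : ∀ a, ∃ b, part b = part a ∧ lt a b
  no_bot : ∀ a, ∃ b, part b = part a ∧ lt b a

/-- The countable ordered random `n`-partite `n`-hypergraph `G_n` (axioms 1–5). -/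
structure RandomNHypergraph (n : ℕ) extends OrderedNPartite n where
  R : (Fin n → G) → Prop
  R_parts : ∀ x, R x → ∀ i, part (x i) = i
  random : ∀ (j : Fin n) (A₀ A₁ : Set (Fin n → G)),
    A₀.Finite → A₁.Finite →
    (∀ y ∈ A₀ ∪ A₁, ∀ i, i ≠ j → part (y i) = i) →
    (∀ y₀ ∈ A₀, ∀ y₁ ∈ A₁, ∃ i, i ≠ j ∧ y₀ i ≠ y₁ i) →
    ∀ b₀ b₁, part b₀ = j → part b₁ = j → lt b₀ b₁ →
      ∃ b, part b = j ∧ lt b₀ b ∧ lt b b₁ ∧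
        (∀ y ∈ A₀, R (Function.update y j b)) ∧
        (∀ y ∈ A₁, ¬ R (Function.update y j b))

/-- Two tuples of indices have the same quantifier-free `O_n`-type. -/
def SameOTp {n : ℕ} (H : OrderedNPartite n) {k : ℕ} (s t : Fin k → H.G) : Prop :=
  (∀ a b, s a = s b ↔ t a = t b) ∧ (∀ a b, H.lt (s a) (s b) ↔ H.lt (t a) (t b)) ∧
    (∀ a, H.part (s a) = H.part (t a))

/-- Two tuples of indices have the same quantifier-free `G_n`-type. -/
def SameGTp {n : ℕ} (H : RandomNHypergraph n) {k : ℕ} (s t : Fin k → H.G) : Prop :=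
  SameOTp H.toOrderedNPartite s t ∧ ∀ f : Fin n → Fin k, (H.R (s ∘ f) ↔ H.R (t ∘ f))

/-- A sequence `(a_g)_{g ∈ G}` of `α`-tuples of `M`, indexed by a structure whose
quantifier-free-type equality is given by `same`, is *indiscernible over* `A ⊆ M` if
index tuples with the same quantifier-free type give rise to tuples with the same type
over `A`. -/
def IndiscernibleOver (L : Lang) (M : Type) [L.Structure M] {G α : Type}
    (same : ∀ k : ℕ, (Fin k → G) → (Fin k → G) → Prop)
    (a : G → α → M) (A : Set M) : Prop :=
  ∀ (k l : ℕ) (s t : Fin k → G), same k s t →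
    ∀ (c : Fin l → M), (∀ j, c j ∈ A) →
      ∀ (φ : L.Formula ((Fin k × α) ⊕ Fin l)),
        (φ.Realize (Sum.elim (fun p => a (s p.1) p.2) c) ↔
          φ.Realize (Sum.elim (fun p => a (t p.1) p.2) c))

/-- `(a_g)` is `O_n`-indiscernible over `A`. -/
def OIndiscernibleOver (L : Lang) (M : Type) [L.Structure M] {n : ℕ}
    (H : RandomNHypergraph n) {α : Type} (a : H.G → α → M) (A : Set M) : Prop :=
  IndiscernibleOver L M (fun _ s t => SameOTp H.toOrderedNPartite s t) a A

/-- `(a_g)` is `G_n`-indiscernible over `A`. -/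
def GIndiscernibleOver (L : Lang) (M : Type) [L.Structure M] {n : ℕ}
    (H : RandomNHypergraph n) {α : Type} (a : H.G → α → M) (A : Set M) : Prop :=
  IndiscernibleOver L M (fun _ s t => SameGTp H s t) a A

/-- The formula `φ(y₁,…,yₙ)` (with parameters `c`) *encodes the edges* of `(a_g)_{g ∈ G_n}`. -/
def EncodesEdges (L : Lang) (M : Type) [L.Structure M] {n : ℕ}
    (H : RandomNHypergraph n) {α : Type} (a : H.G → α → M) {l : ℕ}
    (φ : L.Formula ((Fin n × α) ⊕ Fin l)) (c : Fin l → M) : Prop :=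
  ∀ g : Fin n → H.G, (∀ i, H.part (g i) = i) →
    (φ.Realize (Sum.elim (fun p => a (g p.1) p.2) c) ↔ H.R g)

end Paper

namespace Paper

/-! ## Pure fields as first-order structures -/

/-- A field is `NIP_n` as a pure field (in the language of rings). -/
def FieldIsNIPn (K : Type) [Field K] (n : ℕ) : Prop :=
  letI := FirstOrder.Ring.compatibleRingOfRing K
  IsNIPn FirstOrder.Language.ring K n

/-- A real closed field: `-1` is not a square, every element or its negative is a square,
and every polynomial of odd degree has a root. -/
def IsRealClosedField (K : Type) [Field K] : Prop :=
  (¬ ∃ y : K, y ^ 2 = -1) ∧ (∀ x : K, (∃ y, y ^ 2 = x) ∨ (∃ y, y ^ 2 = -x)) ∧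
    ∀ f : Polynomial K, Odd f.natDegree → ∃ x, f.eval x = 0

/-! ## The three-sorted language of valued fields -/

/-- Relation symbols for the three-sorted language of valued fields: predicates for the three
sorts (field, residue field, value group), graphs of the ring operations on the field sort and
on the residue sort, graphs of the ordered-abelian-group structure on the value-group sort,
and graphs of the valuation map and the residue map. -/
inductive ValRel : ℕ → Type
  | sortK : ValRel 1
  | sortR : ValRel 1
  | sortG : ValRel 1
  | zeroK : ValRel 1
  | oneK : ValRel 1
  | addK : ValRel 3
  | mulK : ValRel 3
  | negK : ValRel 2
  | zeroR : ValRel 1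
  | oneR : ValRel 1
  | addR : ValRel 3
  | mulR : ValRel 3
  | negR : ValRel 2
  | oneG : ValRel 1
  | mulG : ValRel 3
  | invG : ValRel 2
  | leG : ValRel 2
  | vMap : ValRel 2
  | resMap : ValRel 2

/-- The (relational) three-sorted language of valued fields. -/
def valLang : Lang := ⟨fun _ => Empty, ValRel⟩

variable {K : Type} [Field K]

/-- The residue field of a valued field `(K, A)`. -/
abbrev Res (A : ValuationSubring K) : Type := IsLocalRing.ResidueField A

/-- The value group (written multiplicatively, as the units of `A.ValueGroup`). -/
abbrev VGrp (A : ValuationSubring K) : Type := (A.ValueGroup)ˣ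

/-- The underlying set of the three-sorted structure associated to a valued field `(K, A)`:
the disjoint union of the field, its residue field and its value group. -/
def VSort (A : ValuationSubring K) : Type := K ⊕ (Res A ⊕ VGrp A)

/-- The three-sorted valued-field structure on `VSort A`. -/
instance vStruct (A : ValuationSubring K) : valLang.Structure (VSort A) where
  funMap := fun f _ => f.elim
  RelMap := fun r =>
    match r with
    | .sortK => fun x => ∃ a : K, x 0 = Sum.inl a
    | .sortR => fun x => ∃ a : Res A, x 0 = Sum.inr (Sum.inl a)
    | .sortG => fun x => ∃ a : VGrp A, x 0 = Sum.inr (Sum.inr a)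
    | .zeroK => fun x => x 0 = Sum.inl (0 : K)
    | .oneK => fun x => x 0 = Sum.inl (1 : K)
    | .addK => fun x => ∃ a b : K, x 0 = Sum.inl a ∧ x 1 = Sum.inl b ∧ x 2 = Sum.inl (a + b)
    | .mulK => fun x => ∃ a b : K, x 0 = Sum.inl a ∧ x 1 = Sum.inl b ∧ x 2 = Sum.inl (a * b)
    | .negK => fun x => ∃ a : K, x 0 = Sum.inl a ∧ x 1 = Sum.inl (-a)
    | .zeroR => fun x => x 0 = Sum.inr (Sum.inl (0 : Res A))
    | .oneR => fun x => x 0 = Sum.inr (Sum.inl (1 : Res A))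
    | .addR => fun x => ∃ a b : Res A, x 0 = Sum.inr (Sum.inl a) ∧ x 1 = Sum.inr (Sum.inl b) ∧
        x 2 = Sum.inr (Sum.inl (a + b))
    | .mulR => fun x => ∃ a b : Res A, x 0 = Sum.inr (Sum.inl a) ∧ x 1 = Sum.inr (Sum.inl b) ∧
        x 2 = Sum.inr (Sum.inl (a * b))
    | .negR => fun x => ∃ a : Res A, x 0 = Sum.inr (Sum.inl a) ∧ x 1 = Sum.inr (Sum.inl (-a))
    | .oneG => fun x => x 0 = Sum.inr (Sum.inr (1 : VGrp A))
    | .mulG => fun x => ∃ a b : VGrp A, x 0 = Sum.inr (Sum.inr a) ∧ x 1 = Sum.inr (Sum.inr b) ∧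
        x 2 = Sum.inr (Sum.inr (a * b))
    | .invG => fun x => ∃ a : VGrp A, x 0 = Sum.inr (Sum.inr a) ∧ x 1 = Sum.inr (Sum.inr a⁻¹)
    | .leG => fun x => ∃ a b : VGrp A, x 0 = Sum.inr (Sum.inr a) ∧ x 1 = Sum.inr (Sum.inr b) ∧
        (a : A.ValueGroup) ≤ (b : A.ValueGroup)
    | .vMap => fun x => ∃ (a : K) (g : VGrp A), x 0 = Sum.inl a ∧ x 1 = Sum.inr (Sum.inr g) ∧
        A.valuation a = (g : A.ValueGroup)
    | .resMap => fun x => ∃ (a : A) (r : Res A), x 0 = Sum.inl (a : K) ∧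
        x 1 = Sum.inr (Sum.inl r) ∧ IsLocalRing.residue A a = r


/-- Embedding of the field sort into `VSort A`. -/
def fldEmb (A : ValuationSubring K) : K → VSort A := fun a => Sum.inl a

/-- Embedding of the residue sort into `VSort A`. -/
def resEmb (A : ValuationSubring K) : Res A → VSort A := fun r => Sum.inr (Sum.inl r)

/-- Embedding of the value-group sort into `VSort A`. -/
def grpEmb (A : ValuationSubring K) : VGrp A → VSort A := fun g => Sum.inr (Sum.inr g)

/-- The valued field `(K, A)` is `NIP_n` (as a three-sorted structure). -/
def VFIsNIPn (A : ValuationSubring K) (n : ℕ) : Prop :=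
  IsNIPn valLang (VSort A) n

end Paper

namespace Paper

variable {K : Type} [Field K]

/-! ## Valuation-theoretic notions -/

/-- `(K, A)` is trivially valued. -/
def IsTrivialVal (A : ValuationSubring K) : Prop := A = ⊤

/-- `(K, A)` is of equicharacteristic. -/
def EquiChar (A : ValuationSubring K) : Prop := ringChar K = ringChar (Res A)

/-- `(K, A)` has mixed characteristic `(0, p)`. -/
def MixedChar (A : ValuationSubring K) (p : ℕ) : Prop :=
  p.Prime ∧ ringChar K = 0 ∧ ringChar (Res A) = p

/-- `(K, A)` is Kaplansky: if the residue characteristic is a prime `p`, then the value group is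
`p`-divisible and the residue field is perfect and Artin–Schreier closed.  (Valued fields of
residue characteristic `0` are Kaplansky by convention.) -/
def IsKaplansky (A : ValuationSubring K) : Prop :=
  ∀ p : ℕ, p.Prime → ringChar (Res A) = p →
    (∀ g : VGrp A, ∃ h : VGrp A, h ^ p = g) ∧
    PerfectField (Res A) ∧
    (∀ r : Res A, ∃ s : Res A, s ^ p - s = r)

/-- `(L, B)` is an immediate extension of `(K, A)` (along `algebraMap K L`): the valuations are
compatible and the extension has the same value group and the same residue field. -/
def IsImmediateExtension (A : ValuationSubring K) {L : Type} [Field L] [Algebra K L]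
    (B : ValuationSubring L) : Prop :=
  B.comap (algebraMap K L) = A ∧
  (∀ y : L, y ≠ 0 → ∃ x : K, B.valuation (algebraMap K L x) = B.valuation y) ∧
  (∀ y : L, y ∈ B → ∃ x : K, x ∈ A ∧ B.valuation (y - algebraMap K L x) < 1)

/-- `(K, A)` is separably algebraically maximal: it admits no proper immediate separable
algebraic extension. -/
def IsSepAlgMaximal (A : ValuationSubring K) : Prop :=
  ∀ (L : Type) [Field L] [Algebra K L], Algebra.IsSeparable K L →
    ∀ B : ValuationSubring L, IsImmediateExtension A B →
      Function.Surjective (algebraMap K L)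

/-- `(K, A)` is algebraically maximal: it admits no proper immediate algebraic extension. -/
def IsAlgMaximal (A : ValuationSubring K) : Prop :=
  ∀ (L : Type) [Field L] [Algebra K L], Algebra.IsAlgebraic K L →
    ∀ B : ValuationSubring L, IsImmediateExtension A B →
      Function.Surjective (algebraMap K L)

/-- Separably algebraically maximal Kaplansky. -/
def IsSAMK (A : ValuationSubring K) : Prop := IsSepAlgMaximal A ∧ IsKaplansky A

/-- Algebraically maximal Kaplansky. -/
def IsAMK (A : ValuationSubring K) : Prop := IsAlgMaximal A ∧ IsKaplansky A

/-- For `(K, A)` of mixed characteristic: the interval `(0, v(p))` of the value group contains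
finitely many elements (multiplicatively: the interval `(v(p), 1)`). -/
def FinitelyRamified (A : ValuationSubring K) (p : ℕ) : Prop :=
  {g : A.ValueGroup | A.valuation ((p : ℕ) : K) < g ∧ g < 1}.Finite

/-- For `(K, A)` of mixed characteristic: the interval `(0, v(p))` of the value group is empty. -/
def Unramified (A : ValuationSubring K) (p : ℕ) : Prop :=
  {g : A.ValueGroup | A.valuation ((p : ℕ) : K) < g ∧ g < 1} = ∅

/-- `B` is the coarsening `v_p` of `A`: the coarsest coarsening of residue characteristic `p`. -/
def IsCoarsestResCharP (A B : ValuationSubring K) (p : ℕ) : Prop :=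
  A ≤ B ∧ ringChar (Res B) = p ∧
    ∀ B' : ValuationSubring K, A ≤ B' → ringChar (Res B') = p → B' ≤ B

/-- `B` is the coarsening `v_0` of `A`: the finest coarsening of residue characteristic `0`. -/
def IsFinestResChar0 (A B : ValuationSubring K) : Prop :=
  A ≤ B ∧ ringChar (Res B) = 0 ∧
    ∀ B' : ValuationSubring K, A ≤ B' → ringChar (Res B') = 0 → B ≤ B'

/-- Given a coarsening `B` of `A`, the valuation subring `C` of the residue field of `B` is
the one induced by `A` (so that `A` is the composition of `B` and `C`). -/
def InducedOnResidue (A B : ValuationSubring K) (C : ValuationSubring (Res B)) : Prop :=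
  A ≤ B ∧ ∀ x : B, (IsLocalRing.residue B x ∈ C ↔ (x : K) ∈ A)

end Paper

namespace Paper

variable {K : Type} [Field K]

/-! ## Sorts inside (expansions of) valued-field structures, and the conditions (SE)ₙ -/

/-- The field sort of a `valLang`-structure. -/
def fldSet (N : Type) [i : valLang.Structure N] : Set N :=
  {x | @Structure.RelMap valLang N i 1 ValRel.sortK ![x]}

/-- The residue-field sort of a `valLang`-structure. -/
def resSet (N : Type) [i : valLang.Structure N] : Set N :=
  {x | @Structure.RelMap valLang N i 1 ValRel.sortR ![x]}

/-- The value-group sort of a `valLang`-structure. -/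
def grpSet (N : Type) [i : valLang.Structure N] : Set N :=
  {x | @Structure.RelMap valLang N i 1 ValRel.sortG ![x]}

/-- The residue-field sort of an `L'`-structure, where `L'` expands `valLang` via `ι`. -/
def resSetIn (L' : Lang) (ι : valLang →ᴸ L') (N : Type) [L'.Structure N] : Set N :=
  letI := ι.reduct N
  resSet N

/-- The value-group sort of an `L'`-structure, where `L'` expands `valLang` via `ι`. -/
def grpSetIn (L' : Lang) (ι : valLang →ᴸ L') (N : Type) [L'.Structure N] : Set N :=
  letI := ι.reduct N
  grpSet N

/-- The field sort of an `L'`-structure, where `L'` expands `valLang` via `ι`. -/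
def fldSetIn (L' : Lang) (ι : valLang →ᴸ L') (N : Type) [L'.Structure N] : Set N :=
  letI := ι.reduct N
  fldSet N

/-- The condition (SE)ₙ for a theory of valued fields (possibly with extra structure):
in every model, the residue field and the value group are `n`-hanced stably embedded. -/
def TheoryHasSEn (L' : Lang) (ι : valLang →ᴸ L') (T : L'.Theory) (n : ℕ) : Prop :=
  ∀ M : Theory.ModelType.{0, 0, 0} T,
    NHancedSE L' M n (resSetIn L' ι M) ∧ NHancedSE L' M n (grpSetIn L' ι M)

/-- The condition (SE)ₙ for a theory of pure valued fields. -/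
def ValTheoryHasSEn (T : valLang.Theory) (n : ℕ) : Prop :=
  TheoryHasSEn valLang (LHom.id valLang) T n

/-- The residue field of `(K, B)` is `n`-hanced stably embedded *as a pure field* in the
three-sorted structure `VSort B`: every externally definable family of relations on the residue
sort is definable in the pure ring language of the residue field, uniformly. -/
def ResSEPureField (B : ValuationSubring K) (n : ℕ) : Prop :=
  letI := FirstOrder.Ring.compatibleRingOfRing (Res B)
  ∀ (I : Type) (k m : ℕ) (φ : valLang.Formula (Fin k ⊕ (Fin n × Fin m)))
    (a : Fin n → I → Fin m → VSort B),
    ∃ (m' : ℕ) (ψ : FirstOrder.Language.ring.Formula (Fin k ⊕ (Fin n × Fin m')))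
      (b : Fin n → I → Fin m' → Res B),
      ∀ (i : Fin n → I) (x : Fin k → Res B),
        (φ.Realize (Sum.elim (fun l => resEmb B (x l)) (fun p => a p.1 (i p.1) p.2)) ↔
          ψ.Realize (Sum.elim x (fun p => b p.1 (i p.1) p.2)))

end Paper

namespace Paper

section

variable {n : ℕ}

/-- If every point of `P_j` lies below a point of `P_j` satisfying `Q t`, there is an increasing
sequence in `P_j` whose `t`-th term satisfies `Q t`. -/
theorem OrderedNPartite.exists_chain (H : OrderedNPartite n) (j : Fin n) (Q : ℕ → H.G → Prop)
    (hQ : ∀ t b, H.part b = j → ∃ b', H.part b' = j ∧ H.lt b b' ∧ Q t b') :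
    ∃ s : ℕ → H.G, (∀ t, H.part (s t) = j) ∧ (∀ t u, t < u → H.lt (s t) (s u)) ∧
      ∀ t, Q t (s t) := by
  obtain ⟨b₀, hb₀⟩ := H.parts_nonempty j
  choose f hf using fun t (b : {b // H.part b = j}) => hQ t b.1 b.2
  let s : ℕ → {b // H.part b = j} := fun t =>
    Nat.rec ⟨f 0 ⟨b₀, hb₀⟩, (hf _ _).1⟩ (fun t b => ⟨f (t + 1) b, (hf _ _).1⟩) t
  refine ⟨fun t => (s t).1, fun t => (s t).2, fun t u htu => ?_, fun t => ?_⟩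
  · have : IsTrans H.G H.lt := ⟨H.lt_trans⟩
    exact Nat.rel_of_forall_rel_succ_of_lt H.lt (f := fun t => (s t).1)
      (fun t => (hf (t + 1) (s t)).2.1) htu
  · cases t with
    | zero => exact (hf _ _).2.2
    | succ t => exact (hf _ _).2.2

/-- Families of increasing sequences, one in each part. -/
def OrderedNPartite.IsGrid (H : OrderedNPartite n) (g : Fin n → ℕ → H.G) : Prop :=
  (∀ j t, H.part (g j t) = j) ∧ ∀ j t u, t < u → H.lt (g j t) (g j u)

theorem OrderedNPartite.exists_isGrid (H : OrderedNPartite n) : ∃ g, H.IsGrid g := by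
  choose g hg using fun j => H.exists_chain j (fun _ _ => True) (fun _ b hb => by
    obtain ⟨b', h, h'⟩ := H.no_top b
    exact ⟨b', h.trans hb, h', trivial⟩)
  exact ⟨g, fun j => (hg j).1, fun j => (hg j).2.1⟩

theorem OrderedNPartite.IsGrid.lt_iff {H : OrderedNPartite n} {g : Fin n → ℕ → H.G}
    (hg : H.IsGrid g) (p q : Fin n × ℕ) :
    H.lt (g p.1 p.2) (g q.1 q.2) ↔ p.1 < q.1 ∨ p.1 = q.1 ∧ p.2 < q.2 := by
  constructor
  · intro h
    have hle := H.lt_part_mono _ _ h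
    rw [hg.1, hg.1] at hle
    rcases hle.lt_or_eq with h' | h'
    · exact Or.inl h'
    · refine Or.inr ⟨h', ?_⟩
      by_contra! hqp
      rw [h'] at h
      rcases hqp.lt_or_eq with h'' | h''
      · exact H.lt_irrefl _ (H.lt_trans _ _ _ h (hg.2 _ _ _ h''))
      · rw [h''] at h
        exact H.lt_irrefl _ h
  · rintro (h | ⟨h, h'⟩)
    · exact H.parts_ordered _ _ (by rwa [hg.1, hg.1])
    · rw [h]
      exact hg.2 _ _ _ h'

theorem OrderedNPartite.IsGrid.eq_iff {H : OrderedNPartite n} {g : Fin n → ℕ → H.G}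
    (hg : H.IsGrid g) (p q : Fin n × ℕ) : g p.1 p.2 = g q.1 q.2 ↔ p = q := by
  refine ⟨fun h => ?_, fun h => h ▸ rfl⟩
  have hpq : ¬ H.lt (g p.1 p.2) (g q.1 q.2) := h ▸ H.lt_irrefl _
  have hqp : ¬ H.lt (g q.1 q.2) (g p.1 p.2) := h ▸ H.lt_irrefl _
  rw [hg.lt_iff] at hpq hqp
  have h₁ : p.1 = q.1 := by rw [← hg.1 p.1 p.2, h, hg.1]
  exact Prod.ext h₁ (by grind)

theorem OrderedNPartite.IsGrid.sameOTp {H : OrderedNPartite n} {g g' : Fin n → ℕ → H.G}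
    (hg : H.IsGrid g) (hg' : H.IsGrid g') {k : ℕ} (p : Fin k → Fin n × ℕ) :
    SameOTp H (fun i => g (p i).1 (p i).2) (fun i => g' (p i).1 (p i).2) :=
  ⟨fun _ _ => (hg.eq_iff _ _).trans (hg'.eq_iff _ _).symm,
    fun _ _ => (hg.lt_iff _ _).trans (hg'.lt_iff _ _).symm,
    fun _ => (hg.1 _ _).trans (hg'.1 _ _).symm⟩

/-- Every finite edge pattern is realized on some grid. -/
theorem RandomNHypergraph.exists_isGrid_pattern (H : RandomNHypergraph n) (hn : 1 ≤ n) (N : ℕ)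
    (J : Set (Fin n → ℕ)) :
    ∃ g, H.IsGrid g ∧
      ∀ i : Fin n → ℕ, (∀ j, i j < N) → (H.R (fun j => g j (i j)) ↔ i ∈ J) := by
  obtain ⟨g, hg⟩ := H.exists_isGrid
  let j₀ : Fin n := ⟨0, hn⟩
  let box : Set (Fin n → ℕ) := {i | ∀ j, i j < N}
  have hbox : box.Finite :=
    (Set.Finite.pi' (fun _ : Fin n => Set.finite_lt_nat N)).subset fun i hi => hi
  obtain ⟨s, hs, hlt, hQ⟩ := H.exists_chain j₀
    (fun t b => ∀ i ∈ box, i j₀ = t →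
      (H.R (Function.update (fun j => g j (i j)) j₀ b) ↔ i ∈ J)) (by
    intro t b hb
    obtain ⟨b₁, hb₁, hbb₁⟩ := H.no_top b
    obtain ⟨b', hb', h₀, -, hA₀, hA₁⟩ := H.random j₀
      ((fun (i : Fin n → ℕ) j => g j (i j)) '' {i | i ∈ box ∧ i j₀ = t ∧ i ∈ J})
      ((fun (i : Fin n → ℕ) j => g j (i j)) '' {i | i ∈ box ∧ i j₀ = t ∧ i ∉ J})
      ((hbox.subset fun i hi => hi.1).image _) ((hbox.subset fun i hi => hi.1).image _)
      (by rintro _ (⟨i, -, rfl⟩ | ⟨i, -, rfl⟩) j - <;> exact hg.1 _ _)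
      (by
        rintro _ ⟨i, ⟨-, hit, hi⟩, rfl⟩ _ ⟨i', ⟨-, hit', hi'⟩, rfl⟩
        obtain ⟨j, hj⟩ := Function.ne_iff.1 (fun h : i = i' => hi' (h ▸ hi))
        refine ⟨j, fun h => hj (by rw [h, hit, hit']), fun h => hj ?_⟩
        exact congrArg Prod.snd ((hg.eq_iff (j, i j) (j, i' j)).1 h))
      b b₁ hb (hb₁.trans hb) hbb₁
    refine ⟨b', hb', h₀, fun i hi hit => ⟨fun h => ?_, fun h => ?_⟩⟩
    · by_contra hJ
      exact hA₁ _ ⟨i, ⟨hi, hit, hJ⟩, rfl⟩ h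
    · exact hA₀ _ ⟨i, ⟨hi, hit, h⟩, rfl⟩)
  refine ⟨Function.update g j₀ s, ⟨fun j t => ?_, fun j t u htu => ?_⟩, fun i hi => ?_⟩
  · rcases eq_or_ne j j₀ with rfl | h
    · simpa using hs t
    · simpa [h] using hg.1 j t
  · rcases eq_or_ne j j₀ with rfl | h
    · simpa using hlt t u htu
    · simpa [h] using hg.2 j t u htu
  · rw [← hQ (i j₀) i hi rfl]
    refine iff_of_eq (congrArg H.R (funext fun j => ?_))
    rcases eq_or_ne j j₀ with rfl | h <;> simp [*]

variable {L : Lang} {M : Type} [L.Structure M]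

/-- `O_n`-indiscernibility applied to grids, with arbitrary finite index types for the variables
and the parameters. -/
theorem OIndiscernibleOver.realize_grid_iff {H : RandomNHypergraph n} {α : Type}
    {a : H.G → α → M} {A : Set M} (hind : OIndiscernibleOver L M H a A)
    {g g' : Fin n → ℕ → H.G} (hg : H.IsGrid g) (hg' : H.IsGrid g')
    {V P : Type} [Finite V] [Finite P] (p : V → Fin n × ℕ) (c : P → M) (hc : ∀ j, c j ∈ A)
    (θ : L.Formula ((V × α) ⊕ P)) :
    θ.Realize (Sum.elim (fun v => a (g (p v.1).1 (p v.1).2) v.2) c) ↔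
      θ.Realize (Sum.elim (fun v => a (g' (p v.1).1 (p v.1).2) v.2) c) := by
  obtain ⟨k, ⟨e⟩⟩ := Finite.exists_equiv_fin V
  obtain ⟨l, ⟨f⟩⟩ := Finite.exists_equiv_fin P
  have h := hind k l _ _ (hg.sameOTp hg' (p ∘ e.symm)) (c ∘ f.symm) (fun j => hc _)
    (θ.relabel (Sum.map (Prod.map e id) f))
  rw [Formula.realize_relabel, Formula.realize_relabel] at h
  convert h using 2 <;> (ext (v | v) <;> simp)

/-- If `φ(d, y₁,…,yₙ)` with parameters `c` from `A` encodes the edges, then every finite pattern on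
a grid is cut out by `φ(x, y₁,…,yₙ)` for some `x` satisfying the formula `δ` that holds of `d`. -/
theorem OIndiscernibleOver.exists_finite_pattern {H : RandomNHypergraph n} {α : Type}
    {a : H.G → α → M} {A : Set M} (hind : OIndiscernibleOver L M H a A) (hn : 1 ≤ n)
    {g : Fin n → ℕ → H.G} (hg : H.IsGrid g) {P : Type} [Finite P] (c : P → M)
    (hc : ∀ j, c j ∈ A) (δ : L.Formula (Fin 1)) (d : Fin 1 → M) (hd : δ.Realize d)
    (φ : L.Formula (Fin 1 ⊕ ((Fin n × α) ⊕ P)))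
    (hφ : ∀ g : Fin n → H.G, (∀ i, H.part (g i) = i) →
      (φ.Realize (Sum.elim d (Sum.elim (fun p => a (g p.1) p.2) c)) ↔ H.R g))
    (N : ℕ) (J : Set (Fin n → ℕ)) :
    ∃ x : Fin 1 → M, δ.Realize x ∧ ∀ i : Fin n → ℕ, (∀ j, i j < N) →
      (φ.Realize (Sum.elim x (Sum.elim (fun p => a (g p.1 (i p.1)) p.2) c)) ↔ i ∈ J) := by
  classical
  obtain ⟨g', hg', hJ⟩ := H.exists_isGrid_pattern hn N J
  let inst (i : Fin n → Fin N) : L.Formula ((((Fin n × Fin N) × α) ⊕ P) ⊕ Fin 1) :=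
    φ.relabel (Sum.elim Sum.inr (Sum.elim (fun p => Sum.inl (Sum.inl ((p.1, i p.1), p.2)))
      (fun p => Sum.inl (Sum.inr p))))
  let θ : L.Formula (((Fin n × Fin N) × α) ⊕ P) :=
    Formula.iExs (Fin 1) (δ.relabel Sum.inr ⊓ Formula.iInf fun i : Fin n → Fin N =>
      if (fun j => (i j : ℕ)) ∈ J then inst i else (inst i).not)
  have hθ (h : Fin n → ℕ → H.G) :
      θ.Realize (Sum.elim (fun v => a (h v.1.1 v.1.2) v.2) c) ↔
        ∃ x : Fin 1 → M, δ.Realize x ∧ ∀ i : Fin n → Fin N,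
          (φ.Realize (Sum.elim x (Sum.elim (fun p => a (h p.1 (i p.1)) p.2) c)) ↔
            (fun j => (i j : ℕ)) ∈ J) := by
    have hinst (x : Fin 1 → M) (i : Fin n → Fin N) :
        (inst i).Realize (Sum.elim (Sum.elim (fun v => a (h v.1.1 v.1.2) v.2) c) x) ↔
          φ.Realize (Sum.elim x (Sum.elim (fun p => a (h p.1 (i p.1)) p.2) c)) := by
      rw [Formula.realize_relabel]
      refine iff_of_eq (congrArg φ.Realize ?_)
      ext (v | v | v) <;> simp
    simp only [θ, Formula.realize_iExs, Formula.realize_inf, Formula.realize_iInf,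
      Formula.realize_relabel, Sum.elim_comp_inr]
    refine exists_congr fun x => and_congr_right fun _ => forall_congr' fun i => ?_
    split_ifs with hi <;> simp [hinst, hi]
  have key := hind.realize_grid_iff hg' hg (fun v : Fin n × Fin N => (v.1, (v.2 : ℕ))) c hc θ
  rw [hθ g', hθ g] at key
  obtain ⟨x, hx, h⟩ := key.1 ⟨d, hd, fun i => (hφ _ fun j => hg'.1 _ _).trans
    (hJ (fun j => i j) fun j => (i j).2)⟩
  exact ⟨x, hx, fun i hi => h fun j => ⟨i j, hi j⟩⟩

/-- Saturated version of `OIndiscernibleOver.exists_finite_pattern`. -/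
theorem OIndiscernibleOver.exists_pattern (hM : IsMonster L M) {H : RandomNHypergraph n} {α : Type}
    [Countable α] {a : H.G → α → M} {A : Set M} (hind : OIndiscernibleOver L M H a A)
    (hn : 1 ≤ n) {g : Fin n → ℕ → H.G} (hg : H.IsGrid g) {P : Type} [Finite P] (c : P → M)
    (hc : ∀ j, c j ∈ A) (δ : L.Formula (Fin 1)) (d : Fin 1 → M) (hd : δ.Realize d)
    (φ : L.Formula (Fin 1 ⊕ ((Fin n × α) ⊕ P)))
    (hφ : ∀ g : Fin n → H.G, (∀ i, H.part (g i) = i) →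
      (φ.Realize (Sum.elim d (Sum.elim (fun p => a (g p.1) p.2) c)) ↔ H.R g))
    (J : Set (Fin n → ℕ)) :
    ∃ x : Fin 1 → M, δ.Realize x ∧ ∀ i : Fin n → ℕ,
      (φ.Realize (Sum.elim x (Sum.elim (fun p => a (g p.1 (i p.1)) p.2) c)) ↔ i ∈ J) := by
  classical
  let par : ((Fin n × ℕ) × α) ⊕ P → M := Sum.elim (fun v => a (g v.1.1 v.1.2) v.2) c
  let inst (i : Fin n → ℕ) : L.Formula (Fin 1 ⊕ (((Fin n × ℕ) × α) ⊕ P)) :=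
    φ.relabel (Sum.map id (Sum.map (fun p => ((p.1, i p.1), p.2)) id))
  have hinst (x : Fin 1 → M) (i : Fin n → ℕ) : (inst i).Realize (Sum.elim x par) ↔
      φ.Realize (Sum.elim x (Sum.elim (fun p => a (g p.1 (i p.1)) p.2) c)) := by
    rw [Formula.realize_relabel]
    refine iff_of_eq (congrArg φ.Realize ?_)
    ext (v | v | v) <;> simp [par]
  let F (i : Fin n → ℕ) : L.Formula (Fin 1 ⊕ (((Fin n × ℕ) × α) ⊕ P)) :=
    δ.relabel Sum.inl ⊓ if i ∈ J then inst i else (inst i).not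
  have hF (x : Fin 1 → M) (i : Fin n → ℕ) : (F i).Realize (Sum.elim x par) ↔ δ.Realize x ∧
      (φ.Realize (Sum.elim x (Sum.elim (fun p => a (g p.1 (i p.1)) p.2) c)) ↔ i ∈ J) := by
    simp only [F, Formula.realize_inf, Formula.realize_relabel, Sum.elim_comp_inl]
    refine and_congr_right fun _ => ?_
    split_ifs with hi <;> simp [hinst, hi]
  obtain ⟨x, hx⟩ := hM.1 (Fin 1) _ inferInstance inferInstance par (Set.range F) (by
    intro Φ₀ hsub hfin
    choose! ix hix using hsub
    obtain ⟨B, hB⟩ := (hfin.image ix).bddAbove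
    obtain ⟨N, hN⟩ := (Set.finite_range B).bddAbove
    obtain ⟨x, hx, h⟩ := hind.exists_finite_pattern hn hg c hc δ d hd φ hφ (N + 1) J
    refine ⟨x, fun ψ hψ => ?_⟩
    rw [← hix hψ, hF x]
    exact ⟨hx, h _ fun j => Nat.lt_succ_of_le
      ((hB (Set.mem_image_of_mem ix hψ) j).trans (hN (Set.mem_range_self j)))⟩)
  have h (i : Fin n → ℕ) := (hF x i).1 (hx _ ⟨i, rfl⟩)
  exact ⟨x, (h 0).1, fun i => (h i).2⟩

end

/-- Lemma 3.5: if `(a_g)_{g ∈ G_n}` is `O_n`-indiscernible over `A`, `D` is a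
`∅`-definable, `n`-hanced stably embedded set whose induced structure is `NIP_n`, and `d ∈ D`,
then no formula with parameters in `A ∪ {d}` can encode the edges of `(a_g)_{g ∈ G_n}`. -/
theorem no_encoding_over_nipn_set (L : Lang) (M : Type) [L.Structure M]
    (hM : IsMonster L M) (n : ℕ) (hn : 1 ≤ n)
    (H : RandomNHypergraph n) (m : ℕ) (a : H.G → Fin m → M) (A : Set M)
    (hind : OIndiscernibleOver L M H a A)
    (δ : L.Formula (Fin 1)) (D : Set M) (hD : D = {x : M | δ.Realize ![x]})
    (hSE : NHancedSE L M n D)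
    (d : M) (hd : d ∈ D)
    (hNIP : InducedNIPn L M n D) :
    ¬ ∃ (l : ℕ) (φ : L.Formula ((Fin n × Fin m) ⊕ Fin l)) (c : Fin l → M),
        (∀ j, c j ∈ A ∪ {d}) ∧ EncodesEdges L M H a φ c := by
  rintro ⟨l, φ, c, hc, henc⟩
  classical
  subst hD
  obtain ⟨g, hg⟩ := H.exists_isGrid
  let P := {j : Fin l // c j ∈ A}
  let c' : P → M := fun j => c j
  let φ' : L.Formula (Fin 1 ⊕ ((Fin n × Fin m) ⊕ P)) :=
    φ.relabel (Sum.elim (fun v => Sum.inr (Sum.inl v))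
      (fun j => if h : c j ∈ A then Sum.inr (Sum.inr ⟨j, h⟩) else Sum.inl 0))
  have hφ' (v : Fin n × Fin m → M) :
      φ'.Realize (Sum.elim ![d] (Sum.elim v c')) ↔ φ.Realize (Sum.elim v c) := by
    rw [Formula.realize_relabel]
    refine iff_of_eq (congrArg φ.Realize ?_)
    ext (v | j)
    · simp
    · by_cases h : c j ∈ A
      · simp [h, c']
      · have : c j = d := (hc j).resolve_left h
        simp [this, this ▸ h]
  choose x hxδ hx using hind.exists_pattern hM hn hg c' (fun j => j.2) δ ![d] hd φ'
    (fun g hg => (hφ' _).trans (henc g hg))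
  obtain ⟨q, ⟨e⟩⟩ := Finite.exists_equiv_fin P
  obtain ⟨m', ψ, b, hb, hψ⟩ := hSE ℕ 1 (m + q)
    (φ'.relabel (Sum.map id (Sum.elim (fun p => (p.1, Fin.castAdd q p.2))
      (fun p => (⟨0, hn⟩, Fin.natAdd m (e p))))))
    (fun j i => Fin.append (a (g j i)) (c' ∘ e.symm))
  have hxD (J : Set (Fin n → ℕ)) (k : Fin 1) : x J k ∈ {y : M | δ.Realize ![y]} := by
    have : ![x J k] = x J := by ext i; fin_cases i; fin_cases k; rfl
    simpa [this] using hxδ J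
  refine hNIP 1 m' ψ ⟨b, x, hb, hxD, fun J i => ?_⟩
  rw [← hψ i (x J) (hxD J), ← hx J i, Formula.realize_relabel]
  refine iff_of_eq (congrArg φ'.Realize ?_)
  ext (v | v | v) <;> simp

end Paper
end

section
/- Let T be a complete theory with monster model M, let D be a ∅-definable set that is n-hanced stably embedded, let (a_g)_{g∈G_n} be O_n-indiscernible over a set A and fix d ∈ D. Suppose a formula φ(d; y_1,…,y_n) with parameters in A and d encodes the edges of (a_g)_{g∈G_n}. Then for any subset J ⊆ P_1 × … × P_n there exists d_J ∈ D such that M ⊨ φ(d_J; a_{g_1},…,a_{g_n}) holds iff (g_1,…,g_n) ∈ J. (Consequently, via n-hanced stable embeddedness, the induced structure on D has IP_n.) -/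
open FirstOrder FirstOrder.Language

namespace Paper

/-- A self-map of a linear order that is strictly increasing on a given finite set can be found
with values subject to conditions that are satisfied densely. -/
theorem exists_strictMonoOn_of_forall_between {α : Type*} [LinearOrder α] [NoMaxOrder α]
    [Nonempty α] (Q : α → α → Prop) (hQ : ∀ h x y, x < y → ∃ b, x < b ∧ b < y ∧ Q h b)
    (S : Finset α) : ∃ f : α → α, StrictMonoOn f S ∧ ∀ h ∈ S, Q h (f h) := by
  classical
  induction S using Finset.induction_on_max with
  | empty => exact ⟨id, fun _ h => absurd h (by simp), by simp⟩
  | insert a s has ih =>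
    obtain ⟨f, hf, hfQ⟩ := ih
    obtain ⟨u, hu⟩ := (s.image f).exists_le
    obtain ⟨v, huv⟩ := exists_gt u
    obtain ⟨b, hub, -, hb⟩ := hQ a u v huv
    have hfb : ∀ x ∈ s, f x < b := fun x hx => (hu _ (Finset.mem_image_of_mem f hx)).trans_lt hub
    have hne : ∀ x ∈ s, x ≠ a := fun x hx => (has x hx).ne
    refine ⟨Function.update f a b, ?_, ?_⟩
    · intro x hx y hy hxy
      rcases Finset.mem_insert.1 hx with rfl | hxs <;> rcases Finset.mem_insert.1 hy with rfl | hys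
      · exact absurd hxy (lt_irrefl _)
      · exact absurd hxy (has y hys).not_gt
      · simpa [hne x hxs] using hfb x hxs
      · simpa [hne x hxs, hne y hys] using hf hxs hys hxy
    · intro x hx
      rcases Finset.mem_insert.1 hx with rfl | hx
      · simpa using hb
      · simpa [hne x hx] using hfQ x hx

/-- The linear order on a part of an ordered `n`-partite set. -/
@[reducible]
noncomputable def OrderedNPartite.partLinearOrder {n : ℕ} (H : OrderedNPartite n) (j : Fin n) :
    LinearOrder {g : H.G // H.part g = j} where
  le x y := x = y ∨ H.lt x y
  lt x y := H.lt x y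
  le_refl _ := Or.inl rfl
  le_trans := by
    rintro x y z (rfl | hxy) (rfl | hyz)
    · exact Or.inl rfl
    · exact Or.inr hyz
    · exact Or.inr hxy
    · exact Or.inr (H.lt_trans _ _ _ hxy hyz)
  lt_iff_le_not_ge := by
    intro x y
    refine ⟨fun h => ⟨Or.inr h, ?_⟩, ?_⟩
    · rintro (rfl | h')
      · exact H.lt_irrefl _ h
      · exact H.lt_irrefl _ (H.lt_trans _ _ _ h h')
    · rintro ⟨rfl | h, h'⟩
      · exact absurd (Or.inl rfl) h'
      · exact h
  le_antisymm := by
    rintro x y (rfl | hxy) (h | hyx)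
    · rfl
    · rfl
    · exact h.symm
    · exact absurd (H.lt_trans _ _ _ hxy hyx) (H.lt_irrefl _)
  le_total := by
    intro x y
    rcases H.lt_total x y with h | h | h
    · exact Or.inl (Or.inr h)
    · exact Or.inl (Or.inl (Subtype.ext h))
    · exact Or.inr (Or.inr h)
  toDecidableLE := Classical.decRel _

theorem OrderedNPartite.part_noMaxOrder {n : ℕ} (H : OrderedNPartite n) (j : Fin n) :
    letI := H.partLinearOrder j
    NoMaxOrder {g : H.G // H.part g = j} :=
  let _ := H.partLinearOrder j
  ⟨fun x => by
    obtain ⟨b, hb, hlt⟩ := H.no_top x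
    exact ⟨⟨b, hb.trans x.2⟩, hlt⟩⟩

theorem OrderedNPartite.part_nonempty {n : ℕ} (H : OrderedNPartite n) (j : Fin n) :
    Nonempty {g : H.G // H.part g = j} :=
  let ⟨g, hg⟩ := H.parts_nonempty j
  ⟨⟨g, hg⟩⟩

theorem OrderedNPartite.part_infinite {n : ℕ} (H : OrderedNPartite n) (j : Fin n) :
    Infinite {g : H.G // H.part g = j} :=
  let _ := H.partLinearOrder j
  have := H.part_noMaxOrder j
  have := H.part_nonempty j
  NoMaxOrder.infinite

/-- Part-preserving maps that are strictly increasing preserve quantifier-free `O_n`-types. -/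
theorem sameOTp_comp {n : ℕ} (H : OrderedNPartite n) {k : ℕ} (s : Fin k → H.G) (f : H.G → H.G)
    (hpart : ∀ g, H.part (f g) = H.part g)
    (hf : ∀ a b, H.lt (s a) (s b) → H.lt (f (s a)) (f (s b))) : SameOTp H s (f ∘ s) := by
  refine ⟨fun a b => ⟨fun h => congrArg f h, fun h => ?_⟩, fun a b => ⟨hf a b, fun h => ?_⟩,
    fun a => (hpart _).symm⟩
  · rcases H.lt_total (s a) (s b) with h' | h' | h'
    · exact absurd ((show f (s a) = f (s b) from h) ▸ hf a b h') (H.lt_irrefl _)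
    · exact h'
    · exact absurd ((show f (s a) = f (s b) from h) ▸ hf b a h') (H.lt_irrefl _)
  · simp only [Function.comp_apply] at h
    rcases H.lt_total (s a) (s b) with h' | h' | h'
    · exact h'
    · exact absurd (h' ▸ h) (H.lt_irrefl _)
    · exact absurd (H.lt_trans _ _ _ h (hf b a h')) (H.lt_irrefl _)

/-- Every finite `n`-partite pattern on a finite set of vertices of `G_n` is realized by the edge
relation on some set of the same `O_n`-type. -/
theorem RandomNHypergraph.exists_realize_pattern {n : ℕ} (hn : 1 ≤ n) (H : RandomNHypergraph n)
    (S : Finset H.G) (J : Set (Fin n → H.G)) :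
    ∃ f : H.G → H.G, (∀ g, H.part (f g) = H.part g) ∧
      (∀ x ∈ S, ∀ y ∈ S, H.lt x y → H.lt (f x) (f y)) ∧
      ∀ g : Fin n → H.G, (∀ i, H.part (g i) = i) → (∀ i, g i ∈ S) → (H.R (f ∘ g) ↔ g ∈ J) := by
  classical
  let j : Fin n := ⟨0, hn⟩
  let _ := H.partLinearOrder j
  have := H.part_noMaxOrder j
  have := H.part_nonempty j
  let g₀ : H.G := (Classical.arbitrary {g : H.G // H.part g = j}).1
  let T : Set (Fin n → H.G) :=
    {y | (∀ i, y i ∈ insert g₀ S) ∧ (∀ i, i ≠ j → H.part (y i) = i) ∧ y j = g₀}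
  have hT : T.Finite :=
    (Set.Finite.pi' fun _ : Fin n => (insert g₀ S).finite_toSet).subset fun y hy => hy.1
  obtain ⟨f, hfmono, hfQ⟩ := exists_strictMonoOn_of_forall_between
    (α := {g : H.G // H.part g = j})
    (fun h b => ∀ y ∈ T, (H.R (Function.update y j b) ↔ Function.update y j h.1 ∈ J))
    (by
      intro h x y hxy
      obtain ⟨b, hb, hxb, hby, h₀, h₁⟩ := H.random j {y ∈ T | Function.update y j h.1 ∈ J}
        {y ∈ T | Function.update y j h.1 ∉ J} (hT.subset (Set.sep_subset _ _))
        (hT.subset (Set.sep_subset _ _))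
        (by rintro y (hy | hy) <;> exact hy.1.2.1)
        (by
          intro y₀ hy₀ y₁ hy₁
          by_contra! hne
          refine hy₁.2 ?_
          convert hy₀.2 using 1
          ext i
          by_cases hi : i = j
          · subst hi; simp
          · simp [hi, hne i hi])
        x y x.2 y.2 hxy
      refine ⟨⟨b, hb⟩, hxb, hby, fun y hy => ⟨fun hR => ?_, fun hJ => h₀ y ⟨hy, hJ⟩⟩⟩
      by_contra hJ
      exact h₁ y ⟨hy, hJ⟩ hR)
    (S.subtype fun g => H.part g = j)
  let F : H.G → H.G := fun g => if hg : H.part g = j then f ⟨g, hg⟩ else g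
  have hF : ∀ g (hg : H.part g = j), F g = f ⟨g, hg⟩ := fun g hg => dif_pos hg
  have hF' : ∀ g, H.part g ≠ j → F g = g := fun g hg => dif_neg hg
  have hFpart : ∀ g, H.part (F g) = H.part g := by
    intro g
    by_cases hg : H.part g = j
    · rw [hF g hg, (f ⟨g, hg⟩).2, hg]
    · rw [hF' g hg]
  refine ⟨F, hFpart, ?_, ?_⟩
  · intro x hx y hy hxy
    rcases (H.lt_part_mono x y hxy).lt_or_eq with hlt | heq
    · exact H.parts_ordered _ _ (by rwa [hFpart, hFpart])
    · by_cases hxj : H.part x = j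
      · have hyj : H.part y = j := heq ▸ hxj
        rw [hF x hxj, hF y hyj]
        exact hfmono (a := ⟨x, hxj⟩) (b := ⟨y, hyj⟩) (by simpa using hx) (by simpa using hy) hxy
      · rw [hF' x hxj, hF' y (heq ▸ hxj)]
        exact hxy
  · intro g hg hgS
    have hQ := hfQ ⟨g j, hg j⟩ (by simpa using hgS j) (Function.update g j g₀)
      ⟨fun i => by by_cases hi : i = j <;> simp [hi, hgS],
        fun i hi => by simp [hi, hg], by simp⟩
    have hFg : F ∘ g = Function.update g j (f ⟨g j, hg j⟩ : H.G) := by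
      ext i
      by_cases hi : i = j
      · subst hi
        simp [hF _ (hg _)]
      · simp [hi, hF' (g i) (by rwa [hg i])]
    simpa [hFg] using hQ

/-- Over an `O_n`-indiscernible sequence, an edge-encoding instance of a formula can be moved to
one that defines any prescribed pattern on finitely many tuples. -/
theorem exists_realize_finite_pattern {L : Lang} {M : Type} [L.Structure M] {n : ℕ} (hn : 1 ≤ n)
    {H : RandomNHypergraph n} {m : ℕ} {a : H.G → Fin m → M} {A : Set M}
    (hind : OIndiscernibleOver L M H a A) (δ : L.Formula (Fin 1)) (d : M) (hd : δ.Realize ![d])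
    {l : ℕ} (φ : L.Formula ((Fin 1 ⊕ (Fin n × Fin m)) ⊕ Fin l))
    (c : Fin l → M) (hc : ∀ j, c j ∈ A)
    (henc : ∀ g : Fin n → H.G, (∀ i, H.part (g i) = i) →
      (φ.Realize (Sum.elim (Sum.elim ![d] (fun p => a (g p.1) p.2)) c) ↔ H.R g))
    (J : Set (Fin n → H.G)) (T : Finset {g : Fin n → H.G // ∀ i, H.part (g i) = i}) :
    ∃ x : Fin 1 → M, δ.Realize x ∧ ∀ g ∈ T,
      (φ.Realize (Sum.elim (Sum.elim x (fun p => a (g.1 p.1) p.2)) c) ↔ g.1 ∈ J) := by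
  classical
  let S : Finset H.G := T.biUnion fun g => Finset.univ.image g.1
  have hS : ∀ g ∈ T, ∀ i, g.1 i ∈ S := fun g hg i =>
    Finset.mem_biUnion.2 ⟨g, hg, Finset.mem_image_of_mem _ (Finset.mem_univ i)⟩
  obtain ⟨f, hfpart, hflt, hfR⟩ := H.exists_realize_pattern hn S J
  let s : Fin S.card → H.G := fun i => (S.equivFin.symm i).1
  let ix : {g // g ∈ T} → Fin n → Fin S.card := fun g i => S.equivFin ⟨g.1.1 i, hS g.1 g.2 i⟩
  have hix : ∀ g i, s (ix g i) = g.1.1 i := fun g i => by simp [s, ix]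
  let e : {g // g ∈ T} → (Fin 1 ⊕ (Fin n × Fin m)) ⊕ Fin l →
      ((Fin S.card × Fin m) ⊕ Fin l) ⊕ Fin 1 := fun g =>
    Sum.elim (Sum.elim Sum.inr fun p => Sum.inl (Sum.inl (ix g p.1, p.2)))
      fun q => Sum.inl (Sum.inr q)
  let χ : {g // g ∈ T} → L.Formula (((Fin S.card × Fin m) ⊕ Fin l) ⊕ Fin 1) := fun g =>
    if g.1.1 ∈ J then φ.relabel (e g) else (φ.relabel (e g)).not
  let θ : L.Formula ((Fin S.card × Fin m) ⊕ Fin l) :=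
    (δ.relabel Sum.inr ⊓ Formula.iInf χ).iExs (Fin 1)
  have hθ : ∀ t : Fin S.card → H.G,
      θ.Realize (Sum.elim (fun p => a (t p.1) p.2) c) ↔ ∃ x : Fin 1 → M, δ.Realize x ∧
        ∀ g : {g // g ∈ T},
          (φ.Realize (Sum.elim (Sum.elim x fun p => a (t (ix g p.1)) p.2) c) ↔ g.1.1 ∈ J) := by
    intro t
    simp only [θ, Formula.realize_iExs, Formula.realize_inf, Formula.realize_relabel,
      Formula.realize_iInf, Sum.elim_comp_inr]
    refine exists_congr fun x => and_congr_right fun _ => forall_congr' fun g => ?_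
    have he : Sum.elim (Sum.elim (fun p => a (t p.1) p.2) c) x ∘ e g =
        Sum.elim (Sum.elim x fun p => a (t (ix g p.1)) p.2) c := by
      ext ((_ | _) | _) <;> rfl
    by_cases hg : g.1.1 ∈ J <;> simp [χ, hg, he]
  have hmem : ∀ i, s i ∈ S := fun i => (S.equivFin.symm i).2
  have hsame : SameOTp H.toOrderedNPartite s (f ∘ s) :=
    sameOTp_comp _ s f hfpart fun i i' h => hflt _ (hmem i) _ (hmem i') h
  obtain ⟨x, hx, hxT⟩ := (hθ s).1 <| (hind _ _ s (f ∘ s) hsame c hc θ).2 <| (hθ (f ∘ s)).2 <| by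
    refine ⟨![d], hd, fun g => ?_⟩
    have := (henc (f ∘ g.1.1) fun i => (hfpart _).trans (g.1.2 i)).trans
      (hfR g.1.1 g.1.2 (hS g.1 g.2))
    simpa only [Function.comp_apply, hix] using this
  refine ⟨x, hx, fun g hg => ?_⟩
  simpa only [hix] using hxT ⟨g, hg⟩

/-- the Claim in the proof of Lemma 3.5: if `φ(d; y₁,…,yₙ)` (with parameters
in `A` and `d ∈ D`) encodes the edges of an `O_n`-indiscernible sequence `(a_g)_{g ∈ G_n}`, and
`D` is `∅`-definable and `n`-hanced stably embedded, then for every `J ⊆ P₁ × ⋯ × Pₙ` there is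
`d_J ∈ D` with `φ(d_J; a_{g₁},…,a_{gₙ})` iff `(g₁,…,gₙ) ∈ J`; consequently the induced
structure on `D` has `IP_n`. -/
theorem exists_dJ_of_encoding (L : Lang) (M : Type) [L.Structure M]
    (hM : IsMonster L M) (n : ℕ) (hn : 1 ≤ n)
    (H : RandomNHypergraph n) (m : ℕ) (a : H.G → Fin m → M) (A : Set M)
    (hind : OIndiscernibleOver L M H a A)
    (δ : L.Formula (Fin 1)) (D : Set M) (hD : D = {x : M | δ.Realize ![x]})
    (hSE : NHancedSE L M n D)
    (d : M) (hd : d ∈ D)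
    (l : ℕ) (φ : L.Formula ((Fin 1 ⊕ (Fin n × Fin m)) ⊕ Fin l))
    (c : Fin l → M) (hc : ∀ j, c j ∈ A)
    (henc : ∀ g : Fin n → H.G, (∀ i, H.part (g i) = i) →
      (φ.Realize (Sum.elim (Sum.elim ![d] (fun p => a (g p.1) p.2)) c) ↔ H.R g)) :
    (∀ J : Set (Fin n → H.G), ∃ dJ ∈ D,
      ∀ g : Fin n → H.G, (∀ i, H.part (g i) = i) →
        (φ.Realize (Sum.elim (Sum.elim ![dJ] (fun p => a (g p.1) p.2)) c) ↔ g ∈ J)) ∧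
    ¬ InducedNIPn L M n D := by
  classical
  subst hD
  have := H.countable
  have hpat : ∀ J : Set (Fin n → H.G), ∃ dJ ∈ {x : M | δ.Realize ![x]},
      ∀ g : Fin n → H.G, (∀ i, H.part (g i) = i) →
        (φ.Realize (Sum.elim (Sum.elim ![dJ] (fun p => a (g p.1) p.2)) c) ↔ g ∈ J) := by
    intro J
    let e : (Fin n → H.G) → (Fin 1 ⊕ (Fin n × Fin m)) ⊕ Fin l →
        Fin 1 ⊕ ((H.G × Fin m) ⊕ Fin l) := fun g =>
      Sum.elim (Sum.elim Sum.inl fun p => Sum.inr (Sum.inl (g p.1, p.2)))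
        fun q => Sum.inr (Sum.inr q)
    let χ : {g : Fin n → H.G // ∀ i, H.part (g i) = i} →
        L.Formula (Fin 1 ⊕ ((H.G × Fin m) ⊕ Fin l)) := fun g =>
      δ.relabel Sum.inl ⊓ if g.1 ∈ J then φ.relabel (e g.1) else (φ.relabel (e g.1)).not
    have hχ : ∀ g (x : Fin 1 → M),
        (χ g).Realize (Sum.elim x (Sum.elim (fun p => a p.1 p.2) c)) ↔ δ.Realize x ∧
          (φ.Realize (Sum.elim (Sum.elim x (fun p => a (g.1 p.1) p.2)) c) ↔ g.1 ∈ J) := by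
      intro g x
      have he : Sum.elim x (Sum.elim (fun p : H.G × Fin m => a p.1 p.2) c) ∘ e g.1 =
          Sum.elim (Sum.elim x (fun p => a (g.1 p.1) p.2)) c := by
        ext ((_ | _) | _) <;> rfl
      by_cases hg : g.1 ∈ J <;> simp [χ, hg, he]
    obtain ⟨x, hx⟩ := hM.1 (Fin 1) ((H.G × Fin m) ⊕ Fin l) inferInstance inferInstance
      (Sum.elim (fun p => a p.1 p.2) c) (Set.range χ) (by
        intro Φ₀ hΦ₀ hfin
        obtain ⟨T, -, hT⟩ := Finset.subset_set_image_iff (s := Set.univ) (t := hfin.toFinset)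
          (f := χ) |>.1 (by simpa using hΦ₀)
        obtain ⟨x, hxδ, hx⟩ := exists_realize_finite_pattern hn hind δ d hd φ c hc henc J T
        refine ⟨x, fun ψ hψ => ?_⟩
        obtain ⟨g, hg, rfl⟩ : ∃ g ∈ T, χ g = ψ := by
          rw [← Finset.mem_image, hT]
          simpa using hψ
        exact (hχ g x).2 ⟨hxδ, hx g hg⟩)
    have hx₀ : ![x 0] = x := by
      ext i
      rw [Subsingleton.elim i 0]
      rfl
    choose g₀ hg₀ using H.parts_nonempty
    refine ⟨x 0, ?_, fun g hg => ?_⟩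
    · rw [Set.mem_ofPred_eq, hx₀]
      exact ((hχ ⟨g₀, hg₀⟩ x).1 (hx _ ⟨_, rfl⟩)).1
    · rw [hx₀]
      exact ((hχ ⟨g, hg⟩ x).1 (hx _ ⟨_, rfl⟩)).2
  refine ⟨hpat, fun hN => ?_⟩
  have hp : ∀ j, ∃ p : ℕ → H.G, Function.Injective p ∧ ∀ i, H.part (p i) = j := fun j =>
    have := H.part_infinite j
    ⟨fun i => (Infinite.natEmbedding {g : H.G // H.part g = j} i).1,
      Subtype.val_injective.comp (Infinite.natEmbedding _).injective, fun i => (Infinite.natEmbedding {g : H.G // H.part g = j} i).2⟩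
  choose p hpinj hppart using hp
  have hpi : Function.Injective fun (i : Fin n → ℕ) j => p j (i j) := fun i i' h =>
    funext fun j => hpinj j (congrFun h j)
  let e : (Fin 1 ⊕ (Fin n × Fin m)) ⊕ Fin l → Fin 1 ⊕ (Fin n × Fin (m + l)) :=
    Sum.elim (Sum.elim Sum.inl fun q => Sum.inr (q.1, Fin.castAdd l q.2))
      fun q => Sum.inr (⟨0, hn⟩, Fin.natAdd m q)
  obtain ⟨m', ψ, b, hbD, hb⟩ := hSE ℕ 1 (m + l) (φ.relabel e) fun j i => Fin.append (a (p j i)) c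
  choose dd hddD hdd using hpat
  let JJ : Set (Fin n → ℕ) → Set (Fin n → H.G) := fun J => (fun i j => p j (i j)) '' J
  refine hN 1 m' ψ ⟨b, fun J => ![dd (JJ J)], hbD, fun J q => ?_, fun J i => ?_⟩
  · rw [Subsingleton.elim q 0]
    exact hddD (JJ J)
  · rw [← hb i ![dd (JJ J)] fun q => by rw [Subsingleton.elim q 0]; exact hddD (JJ J),
      Formula.realize_relabel]
    have he : Sum.elim ![dd (JJ J)] (fun q : Fin n × Fin (m + l) =>
          Fin.append (a (p q.1 (i q.1))) c q.2) ∘ e =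
        Sum.elim (Sum.elim ![dd (JJ J)] (fun q => a (p q.1 (i q.1)) q.2)) c := by
      ext ((_ | _) | _) <;> simp [e]
    rw [he, hdd (JJ J) (fun j => p j (i j)) fun j => hppart j (i j)]
    exact hpi.mem_set_image

end Paper
end
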